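/- Let ω ∈ ⋀³V* and x, y ∈ V* be linearly independent. If L ∈ ⋀²V satisfies ω(L) ∧ x ∧ y = 0 and (x ∧ y)(L) = 0, then for every c, d ∈ K, (ω ∧ (cx + dy))(L ∧ L) = 0; i.e. the linear space Λ_{ω, x∧y} = {[L] : (x∧y)(L) = 0 and ω(L) ∧ x ∧ y = 0} is contained in every quadric of the pencil generated by Q_{ω∧x} and Q_{ω∧y}. -/

import Mathlib

open Module ExteriorAlgebra

noncomputable section

variable (K V : Type*) [Field K] [AddCommGroup V] [Module K V]

/-- A linear form viewed as an alternating 1-form. -/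
def oneForm (x : Module.Dual K V) : AlternatingMap K V K (Fin 1) :=
  AlternatingMap.ofSubsingleton K V K 0 x

/-- The wedge product `ω ∧ x` of a 3-form and a 1-form, as an alternating
4-form (via the shuffle sum). -/
def wedge31 (ω : AlternatingMap K V K (Fin 3)) (x : Module.Dual K V) :
    AlternatingMap K V K (Fin 4) :=
  (TensorProduct.lid K K).toLinearMap.compAlternatingMap
    ((ω.domCoprod (oneForm K V x)).domDomCongr finSumFinEquiv)

/-- The wedge product `x ∧ y` of two 1-forms, as an alternating 2-form. -/
def wedge11 (x y : Module.Dual K V) : AlternatingMap K V K (Fin 2) :=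
  (TensorProduct.lid K K).toLinearMap.compAlternatingMap
    (((oneForm K V x).domCoprod (oneForm K V y)).domDomCongr
      ((finSumFinEquiv : Fin 1 ⊕ Fin 1 ≃ Fin (1 + 1)).trans (finCongr rfl)))

/-- Evaluation of an alternating `k`-form on elements of the exterior algebra
(extending it by zero in all other degrees). -/
def evalForm (k : ℕ) (φ : AlternatingMap K V K (Fin k)) :
    ExteriorAlgebra K V →ₗ[K] K :=
  ExteriorAlgebra.liftAlternating
    (fun i => if h : i = k then
      cast (show AlternatingMap K V K (Fin k) = AlternatingMap K V K (Fin i) by rw [h]) φ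
      else 0)

end

theorem aux_wedge31_sum {K V : Type*} [Field K] [AddCommGroup V] [Module K V]
    (ω : AlternatingMap K V K (Fin 3)) (z : Module.Dual K V) (v : Fin 4 → V) :
    (6 : K) * wedge31 K V ω z v = ∑ σ : Equiv.Perm (Fin 4),
      ((Equiv.Perm.sign σ : ℤ) : K) * (ω ![v (σ 0), v (σ 1), v (σ 2)] * z (v (σ 3))) := by
  have h := MultilinearMap.domCoprod_alternization_eq ω (oneForm K V z)
  have h' := congrArg (fun f => TensorProduct.lid K K (f (v ∘ finSumFinEquiv))) h
  simp only [Fintype.card_fin, AlternatingMap.smul_apply, map_nsmul] at h'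
  have e : wedge31 K V ω z v = TensorProduct.lid K K
    (ω.domCoprod (oneForm K V z) (v ∘ finSumFinEquiv)) := rfl
  rw [e]
  have h6 : (Nat.factorial 3 * Nat.factorial 1) = 6 := rfl
  rw [h6, nsmul_eq_mul] at h'
  push_cast at h'
  rw [← h', MultilinearMap.alternatization_apply, map_sum,
    ← (Equiv.permCongr (finSumFinEquiv (m := 3) (n := 1))).sum_comp]
  refine Finset.sum_congr rfl fun σ _ => ?_
  rw [Equiv.Perm.sign_permCongr, Units.smul_def, map_zsmul, zsmul_eq_mul]
  congr 1
  simp only [MultilinearMap.domDomCongr_apply, MultilinearMap.domCoprod_apply,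
    TensorProduct.lid_tmul, smul_eq_mul]
  congr 1
  · change ω _ = ω _
    congr 1
    ext i
    fin_cases i <;> rfl

theorem aux_wedge11_sum {K V : Type*} [Field K] [AddCommGroup V] [Module K V]
    (x y : Module.Dual K V) (v : Fin 2 → V) :
    wedge11 K V x y v = ∑ σ : Equiv.Perm (Fin 2),
      ((Equiv.Perm.sign σ : ℤ) : K) * (x (v (σ 0)) * y (v (σ 1))) := by
  have h := MultilinearMap.domCoprod_alternization_eq (oneForm K V x) (oneForm K V y)
  have h' := congrArg (fun f => TensorProduct.lid K K (f (v ∘ finSumFinEquiv))) h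
  simp only [Fintype.card_fin, AlternatingMap.smul_apply, map_nsmul] at h'
  have e : wedge11 K V x y v = TensorProduct.lid K K
    ((oneForm K V x).domCoprod (oneForm K V y) (v ∘ finSumFinEquiv)) := rfl
  rw [e]
  have h6 : (Nat.factorial 1 * Nat.factorial 1) = 1 := rfl
  rw [h6, one_smul] at h'
  rw [← h', MultilinearMap.alternatization_apply, map_sum,
    ← (Equiv.permCongr (finSumFinEquiv (m := 1) (n := 1))).sum_comp]
  refine Finset.sum_congr rfl fun σ _ => ?_
  rw [Equiv.Perm.sign_permCongr, Units.smul_def, map_zsmul, zsmul_eq_mul]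
  congr 1

theorem aux_wedge11 {K V : Type*} [Field K] [AddCommGroup V] [Module K V]
    (x y : Module.Dual K V) (a b : V) :
    wedge11 K V x y ![a, b] = x a * y b - x b * y a := by
  rw [aux_wedge11_sum, Finset.univ_perm_fin_succ, ← Finset.univ_product_univ]
  simp [Finset.sum_product, Fin.sum_univ_succ, Equiv.Perm.decomposeFin.symm_sign]
  ring

theorem aux_swap01 {K V : Type*} [Field K] [AddCommGroup V] [Module K V]
    (ω : AlternatingMap K V K (Fin 3)) (a b c : V) : ω ![b, a, c] = - ω ![a, b, c] := by
  rw [← ω.map_swap ![a, b, c] (i := 0) (j := 1) (by decide)]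
  congr 1; ext i; fin_cases i <;> rfl

theorem aux_swap12 {K V : Type*} [Field K] [AddCommGroup V] [Module K V]
    (ω : AlternatingMap K V K (Fin 3)) (a b c : V) : ω ![a, c, b] = - ω ![a, b, c] := by
  rw [← ω.map_swap ![a, b, c] (i := 1) (j := 2) (by decide)]
  congr 1; ext i; fin_cases i <;> rfl

theorem aux_wedge31 {K V : Type*} [Field K] [CharZero K] [AddCommGroup V] [Module K V]
    (ω : AlternatingMap K V K (Fin 3)) (z : Module.Dual K V) (a b c d : V) :
    wedge31 K V ω z ![a, b, c, d] = ω ![a, b, c] * z d - ω ![a, b, d] * z c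
      + ω ![c, d, a] * z b - ω ![c, d, b] * z a := by
  have h := aux_wedge31_sum ω z ![a, b, c, d]
  have p1 : ∀ a b c, ω ![b, a, c] = - ω ![a, b, c] := aux_swap01 ω
  have p2 : ∀ a b c, ω ![a, c, b] = - ω ![a, b, c] := aux_swap12 ω
  have p3 : ∀ a b c, ω ![b, c, a] = ω ![a, b, c] := fun a b c => by rw [p2, p1, neg_neg]
  have p4 : ∀ a b c, ω ![c, a, b] = ω ![a, b, c] := fun a b c => by rw [p1, p2, neg_neg]
  have p5 : ∀ a b c, ω ![c, b, a] = - ω ![a, b, c] := fun a b c => by rw [p1, p3]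
  have q1 : ∀ (p : Fin 4) (e : Equiv.Perm (Fin 3)), Equiv.Perm.decomposeFin.symm (p, e) 2
      = Equiv.swap 0 p (e 1).succ := fun p e => Equiv.Perm.decomposeFin_symm_apply_succ e p 1
  have q2 : ∀ (p : Fin 4) (e : Equiv.Perm (Fin 3)), Equiv.Perm.decomposeFin.symm (p, e) 3
      = Equiv.swap 0 p (e 2).succ := fun p e => Equiv.Perm.decomposeFin_symm_apply_succ e p 2
  have q3 : ∀ (p : Fin 3) (e : Equiv.Perm (Fin 2)), Equiv.Perm.decomposeFin.symm (p, e) 2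
      = Equiv.swap 0 p (e 1).succ := fun p e => Equiv.Perm.decomposeFin_symm_apply_succ e p 1
  have h6 : (6 : K) ≠ 0 := by norm_num
  apply mul_left_cancel₀ h6
  rw [h, Finset.univ_perm_fin_succ, ← Finset.univ_product_univ]
  simp only [Finset.sum_map, Finset.univ_perm_fin_succ, ← Finset.univ_product_univ]
  simp [Finset.sum_product, Fin.sum_univ_succ, Equiv.Perm.decomposeFin.symm_sign,
    q1, q2, q3, Equiv.swap_apply_def]
  rw [p1 a b c, p2 a b c, p3 a b c, p4 a b c, p5 a b c,
    p1 a b d, p2 a b d, p3 a b d, p4 a b d, p5 a b d,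
    p1 a c d, p2 a c d, p3 a c d, p4 a c d, p5 a c d,
    p1 b c d, p2 b c d, p3 b c d, p4 b c d, p5 b c d]
  ring

theorem aux_eval {K V : Type*} [Field K] [AddCommGroup V] [Module K V] (k : ℕ)
    (φ : AlternatingMap K V K (Fin k)) (v : Fin k → V) :
    evalForm K V k φ (ExteriorAlgebra.ιMulti K k v) = φ v := by
  simp [evalForm, ExteriorAlgebra.liftAlternating_apply_ιMulti]

theorem aux_eval2 {K V : Type*} [Field K] [AddCommGroup V] [Module K V]
    (φ : AlternatingMap K V K (Fin 2)) (a b : V) :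
    evalForm K V 2 φ (ExteriorAlgebra.ι K a * ExteriorAlgebra.ι K b) = φ ![a, b] := by
  rw [← aux_eval]; simp [ExteriorAlgebra.ιMulti_apply]

theorem aux_eval3 {K V : Type*} [Field K] [AddCommGroup V] [Module K V]
    (φ : AlternatingMap K V K (Fin 3)) (a b c : V) :
    evalForm K V 3 φ (ExteriorAlgebra.ι K a * ExteriorAlgebra.ι K b * ExteriorAlgebra.ι K c)
      = φ ![a, b, c] := by
  rw [← aux_eval]; simp [ExteriorAlgebra.ιMulti_apply, mul_assoc]

theorem aux_eval4 {K V : Type*} [Field K] [AddCommGroup V] [Module K V]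
    (φ : AlternatingMap K V K (Fin 4)) (a b c d : V) :
    evalForm K V 4 φ (ExteriorAlgebra.ι K a * ExteriorAlgebra.ι K b *
      (ExteriorAlgebra.ι K c * ExteriorAlgebra.ι K d)) = φ ![a, b, c, d] := by
  rw [← aux_eval]; simp [ExteriorAlgebra.ιMulti_apply, mul_assoc]

theorem aux_span {K V : Type*} [Field K] [AddCommGroup V] [Module K V] :
    (⋀[K]^2 V) = Submodule.span K
      {m | ∃ a b : V, m = ExteriorAlgebra.ι K a * ExteriorAlgebra.ι K b} := by
  rw [← ExteriorAlgebra.ιMulti_span_fixedDegree]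
  congr 1
  ext m
  constructor
  · rintro ⟨v, rfl⟩
    exact ⟨v 0, v 1, by simp [ExteriorAlgebra.ιMulti_apply, Matrix.vecTail]⟩
  · rintro ⟨a, b, rfl⟩
    exact ⟨![a, b], by simp [ExteriorAlgebra.ιMulti_apply]⟩

theorem aux_contract {K V : Type*} [Field K] [AddCommGroup V] [Module K V]
    (z : Module.Dual K V) (a b : V) :
    CliffordAlgebra.contractLeft (Q := (0 : QuadraticForm K V)) z
      (ExteriorAlgebra.ι K a * ExteriorAlgebra.ι K b)
      = ExteriorAlgebra.ι K (z a • b - z b • a) := by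
  refine (CliffordAlgebra.contractLeft_ι_mul (Q := (0 : QuadraticForm K V)) z a _).trans ?_
  have := CliffordAlgebra.contractLeft_ι (Q := (0 : QuadraticForm K V)) z b
  erw [this]
  rw [← Algebra.commutes, ← Algebra.smul_def, map_sub, map_smul, map_smul]

theorem aux_D {K V : Type*} [Field K] [AddCommGroup V] [Module K V]
    (M : ExteriorAlgebra K V) (hM : M ∈ ⋀[K]^2 V) :
    ∃ D : Module.Dual K V →ₗ[K] V, (∀ z, CliffordAlgebra.contractLeft
      (Q := (0 : QuadraticForm K V)) z M = ExteriorAlgebra.ι K (D z)) ∧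
      (∀ x y, y (D x) = evalForm K V 2 (wedge11 K V x y) M) ∧
      (∀ x : Module.Dual K V, x (D x) = 0) ∧ (∀ x y : Module.Dual K V, y (D x) = - x (D y)) := by
  rw [aux_span] at hM
  induction hM using Submodule.span_induction with
  | mem m hm =>
    obtain ⟨a, b, rfl⟩ := hm
    refine ⟨(LinearMap.applyₗ a).smulRight b - (LinearMap.applyₗ b).smulRight a, ?_, ?_, ?_, ?_⟩
    · intro z
      rw [aux_contract]; simp
    · intro x y
      rw [aux_eval2, aux_wedge11]; simp
    · intro x
      simp [mul_comm]
    · intro x y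
      simp [mul_comm]
  | zero => exact ⟨0, by simp⟩
  | add m n _ _ hm hn =>
    obtain ⟨D, h1, h2, h3, h4⟩ := hm
    obtain ⟨E, k1, k2, k3, k4⟩ := hn
    refine ⟨D + E, ?_, ?_, ?_, ?_⟩
    · intro z; simp [h1, k1]
    · intro x y; simp [h2, k2]
    · intro x; simp [h3, k3]
    · intro x y; simp only [LinearMap.add_apply, map_add, h4 x y, k4 x y]; ring
  | smul r m _ hm =>
    obtain ⟨D, h1, h2, h3, h4⟩ := hm
    refine ⟨r • D, ?_, ?_, ?_, ?_⟩
    · intro z; simp [h1]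
    · intro x y; simp [h2]
    · intro x; simp [h3]
    · intro x y; simp only [LinearMap.smul_apply, map_smul, h4 x y, smul_neg]

theorem aux_identity {K V : Type*} [Field K] [CharZero K] [AddCommGroup V] [Module K V]
    (ω : AlternatingMap K V K (Fin 3)) (z : Module.Dual K V)
    (M N : ExteriorAlgebra K V) (hM : M ∈ ⋀[K]^2 V) (hN : N ∈ ⋀[K]^2 V) :
    evalForm K V 4 (wedge31 K V ω z) (M * N) =
      - evalForm K V 3 ω (M * CliffordAlgebra.contractLeft (Q := (0 : QuadraticForm K V)) z N)
      - evalForm K V 3 ω (N * CliffordAlgebra.contractLeft (Q := (0 : QuadraticForm K V)) z M)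
      := by
  rw [aux_span] at hM hN
  induction hM, hN using Submodule.span_induction₂ with
  | mem_mem m n hm hn =>
    obtain ⟨a, b, rfl⟩ := hm
    obtain ⟨c, d, rfl⟩ := hn
    rw [aux_contract, aux_contract, aux_eval4, aux_wedge31]
    simp only [map_sub, map_smul, mul_sub, mul_smul_comm, aux_eval3, smul_eq_mul]
    ring
  | zero_left => simp
  | zero_right => simp
  | add_left m m' n _ _ _ h h' => simp only [add_mul, mul_add, map_add, h, h']; ring
  | add_right m n n' _ _ _ h h' => simp only [add_mul, mul_add, map_add, h, h']; ring
  | smul_left r m n _ _ h =>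
    simp only [smul_mul_assoc, mul_smul_comm, map_smul, h, smul_eq_mul]; ring
  | smul_right r m n _ _ h =>
    simp only [smul_mul_assoc, mul_smul_comm, map_smul, h, smul_eq_mul]; ring

/-- Two independent forms have a nonzero `2 × 2` minor. -/
theorem aux_minor {K V : Type*} [Field K] [AddCommGroup V] [Module K V]
    (x y : Module.Dual K V) (hxy : LinearIndependent K ![x, y]) :
    ∃ b c : V, x b * y c - x c * y b ≠ 0 := by
  by_contra! h
  rw [LinearIndependent.pair_iff] at hxy
  by_cases hx : x = 0
  · have := hxy 1 0 (by simp [hx])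
    simp at this
  · obtain ⟨b, hb⟩ : ∃ b, x b ≠ 0 := by
      by_contra! h'
      exact hx (LinearMap.ext h')
    have := hxy (- y b) (x b) (by
      ext c
      have := h b c
      simp only [LinearMap.add_apply, LinearMap.smul_apply, smul_eq_mul, LinearMap.zero_apply]
      linear_combination this)
    exact hb this.2

/-- Let `x, y ∈ V*` be linearly independent and `ω ∈ ⋀³V*`. If `L ∈ ⋀²V`
satisfies `ω(L) ∧ x ∧ y = 0` (the 3-form built from the contraction
`ω(L) : v ↦ ω(L ∧ v)` together with `x` and `y` vanishes) and `(x ∧ y)(L) = 0`,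
then `(ω ∧ (cx + dy))(L ∧ L) = 0` for all scalars `c, d`; i.e. the linear space
`Λ_{ω,x∧y}` lies in every quadric of the pencil generated by `Q_{ω∧x}` and
`Q_{ω∧y}`. -/
theorem stmt_9 (K V : Type*) [Field K] [CharZero K] [AddCommGroup V] [Module K V]
    (ω : AlternatingMap K V K (Fin 3)) (x y : Module.Dual K V)
    (hxy : LinearIndependent K ![x, y])
    (L : ExteriorAlgebra K V) (hL : L ∈ ⋀[K]^2 V)
    (h1 : ∀ a b c : V,
      Matrix.det (Matrix.of fun i j =>
        ![fun v => evalForm K V 3 ω (L * ExteriorAlgebra.ι K v), ⇑x, ⇑y] i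
          (![a, b, c] j)) = 0)
    (h2 : evalForm K V 2 (wedge11 K V x y) L = 0) :
    ∀ c d : K, evalForm K V 4 (wedge31 K V ω (c • x + d • y)) (L * L) = 0 := by
  intro c d
  obtain ⟨D, hD, hD2, hD3, hD4⟩ := aux_D L hL
  rw [aux_identity ω _ L L hL hL, hD]
  obtain ⟨p, q, hpq⟩ := aux_minor x y hxy
  have hyx : y (D x) = 0 := by rw [hD2, h2]
  have hxy0 : x (D y) = 0 := by rw [hD4, hyx, neg_zero]
  have key := h1 (D (c • x + d • y)) p q
  have e1 : x (D (c • x + d • y)) = 0 := by simp [hD3, hxy0]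
  have e2 : y (D (c • x + d • y)) = 0 := by simp [hD3, hyx]
  rw [Matrix.det_fin_three] at key
  simp [e1, e2, -map_add, -map_smul] at key
  have key2 : evalForm K V 3 ω (L * ExteriorAlgebra.ι K (D (c • x + d • y))) *
      (x p * y q - x q * y p) = 0 := by
    simp only [map_add, map_smul] at key ⊢
    linear_combination key
  rcases mul_eq_zero.1 key2 with h | h
  · rw [h]; simp
  · exact absurd h hpq
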